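/- arXiv:2103.06185 — 4 statements merged into one kernel-verified Lean document; each statement's English description precedes it below -/
import Mathlib

section
/- Let U be a real n×ℓ matrix, P a selection matrix built from ℓ distinct indices of {1,…,n}, and assume PᵀU is invertible. Writing 𝒫 := U (PᵀU)⁻¹ Pᵀ, for every f ∈ ℝⁿ the DEIM error admits the factorization f − 𝒫f = (I − 𝒫)(I − UUᵀ)f, where I is the n×n identity matrix. -/
open Matrix

/-- **DEIM error factorization.** With `𝒫 := U (PᵀU)⁻¹ Pᵀ` the DEIM oblique projector,
for every `f ∈ ℝⁿ` one has `f − 𝒫 f = (I − 𝒫)(I − U Uᵀ) f`. -/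
theorem deim_error_factorization
    (n ℓ : ℕ) (hn : 0 < n) (hℓ : 0 < ℓ) (hℓn : ℓ ≤ n)
    (U P : Matrix (Fin n) (Fin ℓ) ℝ)
    (p : Fin ℓ → Fin n) (hp : Function.Injective p)
    (hP : ∀ i j, P i j = if i = p j then (1 : ℝ) else 0)
    (hinv : IsUnit (Pᵀ * U))
    (f : Fin n → ℝ) :
    f - (U * (Pᵀ * U)⁻¹ * Pᵀ).mulVec f =
      ((1 - U * (Pᵀ * U)⁻¹ * Pᵀ) * (1 - U * Uᵀ)).mulVec f := by
  have hdet : IsUnit (Pᵀ * U).det := (Matrix.isUnit_iff_isUnit_det _).mp hinv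
  have hPU : U * (Pᵀ * U)⁻¹ * Pᵀ * U = U := by
    rw [Matrix.mul_assoc, Matrix.mul_assoc, Matrix.nonsing_inv_mul _ hdet, Matrix.mul_one]
  have h0 : (1 - U * (Pᵀ * U)⁻¹ * Pᵀ) * (U * Uᵀ) = 0 := by
    rw [← Matrix.mul_assoc, Matrix.sub_mul, Matrix.one_mul, hPU, sub_self, Matrix.zero_mul]
  rw [Matrix.mul_sub, h0, Matrix.mul_one, sub_zero, Matrix.sub_mulVec, Matrix.one_mulVec]
end

section
/- Let U be a real n×ℓ matrix whose columns are orthonormal (UᵀU = I_ℓ), and let P be a selection matrix built from ℓ distinct indices of {1,…,n} such that PᵀU is invertible. Then for every f ∈ ℝⁿ, the DEIM approximation f̃ = U (PᵀU)⁻¹ Pᵀ f satisfies the error bound ‖f − f̃‖₂ ≤ ‖(PᵀU)⁻¹‖₂ · ‖f − UUᵀf‖₂, where ‖·‖₂ on vectors is the Euclidean norm and ‖(PᵀU)⁻¹‖₂ is the spectral norm of (PᵀU)⁻¹. -/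
open Matrix

/-- The operator norm of a real matrix induced by the Euclidean vector norm
(i.e. its largest singular value). -/
noncomputable def spectralNorm2 {m n : ℕ} (A : Matrix (Fin m) (Fin n) ℝ) : ℝ :=
  ‖LinearMap.toContinuousLinearMap (Matrix.toEuclideanLin A)‖

/-- The Euclidean (ℓ²) norm of a vector in `ℝⁿ`. -/
noncomputable def euclNorm2 {n : ℕ} (v : Fin n → ℝ) : ℝ :=
  ‖(WithLp.equiv 2 (Fin n → ℝ)).symm v‖

theorem euclNorm2_sq {n : ℕ} (v : Fin n → ℝ) : euclNorm2 v ^ 2 = v ⬝ᵥ v := by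
  unfold euclNorm2
  rw [EuclideanSpace.norm_sq_eq]
  simp [dotProduct, sq]

theorem euclNorm2_nonneg {n : ℕ} (v : Fin n → ℝ) : 0 ≤ euclNorm2 v := norm_nonneg _

theorem spectralNorm2_nonneg {m n : ℕ} (A : Matrix (Fin m) (Fin n) ℝ) :
    0 ≤ spectralNorm2 A := norm_nonneg _

theorem euclNorm2_mulVec_le {m n : ℕ} (A : Matrix (Fin m) (Fin n) ℝ) (v : Fin n → ℝ) :
    euclNorm2 (A *ᵥ v) ≤ spectralNorm2 A * euclNorm2 v :=
  (LinearMap.toContinuousLinearMap (Matrix.toEuclideanLin A)).le_opNorm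
    ((WithLp.equiv 2 (Fin n → ℝ)).symm v)

theorem mulVec_dot_mulVec {m n k : ℕ} (A : Matrix (Fin m) (Fin n) ℝ)
    (B : Matrix (Fin m) (Fin k) ℝ) (x : Fin n → ℝ) (y : Fin k → ℝ) :
    (A *ᵥ x) ⬝ᵥ (B *ᵥ y) = x ⬝ᵥ ((Aᵀ * B) *ᵥ y) := by
  rw [← Matrix.mulVec_mulVec, Matrix.dotProduct_mulVec x, Matrix.vecMul_transpose]

theorem dot_mulVec' {m n : ℕ} (A : Matrix (Fin m) (Fin n) ℝ)
    (x : Fin m → ℝ) (y : Fin n → ℝ) :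
    x ⬝ᵥ (A *ᵥ y) = (Aᵀ *ᵥ x) ⬝ᵥ y := by
  rw [Matrix.dotProduct_mulVec, Matrix.mulVec_transpose]

theorem dot_cs {n : ℕ} (x y : Fin n → ℝ) : (x ⬝ᵥ y) ^ 2 ≤ (x ⬝ᵥ x) * (y ⬝ᵥ y) := by
  have := Finset.sum_mul_sq_le_sq_mul_sq Finset.univ x y
  simpa [dotProduct, sq] using this

theorem dot_self_nonneg' {n : ℕ} (x : Fin n → ℝ) : 0 ≤ x ⬝ᵥ x :=
  Finset.sum_nonneg fun i _ => mul_self_nonneg (x i)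

theorem le_of_sq_le_sq_aux {x y : ℝ} (hy : 0 ≤ y) (h : x ^ 2 ≤ y ^ 2) : x ≤ y :=
  (le_abs_self x).trans (abs_le_of_sq_le_sq h hy)

/-- **DEIM error bound.** If the columns of `U` are orthonormal (`UᵀU = I`) and `PᵀU`
is invertible, with `P` the selection matrix of `ℓ` distinct indices, then for every
`f ∈ ℝⁿ` the DEIM approximation `f̃ = U (PᵀU)⁻¹ Pᵀ f` satisfies
`‖f − f̃‖₂ ≤ ‖(PᵀU)⁻¹‖₂ · ‖f − U Uᵀ f‖₂`. -/
theorem deim_error_bound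
    (n ℓ : ℕ) (hn : 0 < n) (hℓ : 0 < ℓ) (hℓn : ℓ ≤ n)
    (U P : Matrix (Fin n) (Fin ℓ) ℝ)
    (hU : Uᵀ * U = 1)
    (p : Fin ℓ → Fin n) (hp : Function.Injective p)
    (hP : ∀ i j, P i j = if i = p j then (1 : ℝ) else 0)
    (hinv : IsUnit (Pᵀ * U))
    (f : Fin n → ℝ) :
    euclNorm2 (f - (U * (Pᵀ * U)⁻¹ * Pᵀ).mulVec f) ≤
      spectralNorm2 (Pᵀ * U)⁻¹ * euclNorm2 (f - (U * Uᵀ).mulVec f) := by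
  have hPP : Pᵀ * P = 1 := by
    ext i j
    simp only [Matrix.mul_apply, Matrix.transpose_apply, hP, Matrix.one_apply]
    simp [hp.eq_iff, eq_comm]
  have hdet : IsUnit (Pᵀ * U).det := (Matrix.isUnit_iff_isUnit_det _).1 hinv
  have hs0 := spectralNorm2_nonneg (Pᵀ * U)⁻¹
  obtain ⟨M, hM⟩ : ∃ M, M = Pᵀ * U := ⟨_, rfl⟩
  rw [← hM] at hdet hs0 ⊢
  have hMi : M⁻¹ * M = 1 := Matrix.nonsing_inv_mul _ hdet
  have hMi' : M * M⁻¹ = 1 := Matrix.mul_nonsing_inv _ hdet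
  generalize hs : spectralNorm2 M⁻¹ = s at *
  have key1 : ∀ y : Fin ℓ → ℝ, y ⬝ᵥ y ≤ s ^ 2 * ((M *ᵥ y) ⬝ᵥ (M *ᵥ y)) := by
    intro y
    have h := euclNorm2_mulVec_le M⁻¹ (M *ᵥ y)
    rw [Matrix.mulVec_mulVec, hMi, Matrix.one_mulVec, hs] at h
    have h2 := pow_le_pow_left₀ (euclNorm2_nonneg _) h 2
    rwa [mul_pow, euclNorm2_sq, euclNorm2_sq] at h2
  have key2 : ∀ y : Fin ℓ → ℝ,
      (U *ᵥ y - P *ᵥ (M *ᵥ y)) ⬝ᵥ (U *ᵥ y - P *ᵥ (M *ᵥ y))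
        = y ⬝ᵥ y - (M *ᵥ y) ⬝ᵥ (M *ᵥ y) := by
    intro y
    have e1 : (U *ᵥ y) ⬝ᵥ (U *ᵥ y) = y ⬝ᵥ y := by
      rw [mulVec_dot_mulVec, hU, Matrix.one_mulVec]
    have e2 : (P *ᵥ (M *ᵥ y)) ⬝ᵥ (P *ᵥ (M *ᵥ y)) = (M *ᵥ y) ⬝ᵥ (M *ᵥ y) := by
      rw [mulVec_dot_mulVec, hPP, Matrix.one_mulVec]
    have e3 : (P *ᵥ (M *ᵥ y)) ⬝ᵥ (U *ᵥ y) = (M *ᵥ y) ⬝ᵥ (M *ᵥ y) := by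
      rw [mulVec_dot_mulVec, ← hM]
    rw [sub_dotProduct, dotProduct_sub, dotProduct_sub, e1, e2, e3,
      dotProduct_comm (U *ᵥ y), e3]
    ring
  have hs1 : 1 ≤ s ^ 2 := by
    let y : Fin ℓ → ℝ := Pi.single ⟨0, hℓ⟩ 1
    have hy : y ⬝ᵥ y = 1 := by simp [y]
    have h1 := key1 y
    have h2 := key2 y
    have h3 := dot_self_nonneg' (U *ᵥ y - P *ᵥ (M *ᵥ y))
    rw [hy] at h1 h2
    nlinarith [sq_nonneg s]
  obtain ⟨w, hw⟩ : ∃ w, w = f - (U * Uᵀ) *ᵥ f := ⟨_, rfl⟩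
  obtain ⟨z, hz⟩ : ∃ z, z = M⁻¹ *ᵥ (Pᵀ *ᵥ w) := ⟨_, rfl⟩
  have hUw : Uᵀ *ᵥ w = 0 := by
    rw [hw, Matrix.mulVec_sub, Matrix.mulVec_mulVec, ← Matrix.mul_assoc, hU, Matrix.one_mul,
      sub_self]
  have hMz : M *ᵥ z = Pᵀ *ᵥ w := by
    rw [hz, Matrix.mulVec_mulVec, hMi', Matrix.one_mulVec]
  have hr : f - (U * M⁻¹ * Pᵀ) *ᵥ f = w - U *ᵥ z := by
    have hD : U * M⁻¹ * Pᵀ * (U * Uᵀ) = U * Uᵀ := by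
      calc U * M⁻¹ * Pᵀ * (U * Uᵀ) = U * (M⁻¹ * (Pᵀ * U)) * Uᵀ := by
            simp only [Matrix.mul_assoc]
        _ = U * Uᵀ := by rw [← hM, hMi, Matrix.mul_one]
    rw [hz, Matrix.mulVec_mulVec, Matrix.mulVec_mulVec, hw,
      Matrix.mulVec_sub, Matrix.mulVec_mulVec, hD]
    abel
  rw [hr, ← hw]
  have hwU : w ⬝ᵥ (U *ᵥ z) = 0 := by rw [dot_mulVec', hUw, zero_dotProduct]
  have hUU : (U *ᵥ z) ⬝ᵥ (U *ᵥ z) = z ⬝ᵥ z := by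
    rw [mulVec_dot_mulVec, hU, Matrix.one_mulVec]
  have hrr : (w - U *ᵥ z) ⬝ᵥ (w - U *ᵥ z) = w ⬝ᵥ w + z ⬝ᵥ z := by
    rw [sub_dotProduct, dotProduct_sub, dotProduct_sub, hwU, dotProduct_comm (U *ᵥ z) w, hwU, hUU]
    ring
  have hrP : (w - U *ᵥ z) ⬝ᵥ (P *ᵥ (M *ᵥ z)) = 0 := by
    rw [dot_mulVec', Matrix.mulVec_sub, Matrix.mulVec_mulVec, ← hM, hMz, sub_self,
      zero_dotProduct]
  have hrv : (w - U *ᵥ z) ⬝ᵥ (U *ᵥ z - P *ᵥ (M *ᵥ z)) = - (z ⬝ᵥ z) := by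
    rw [dotProduct_sub, hrP, sub_dotProduct, hwU, hUU]
    ring
  have hcs := dot_cs (w - U *ᵥ z) (U *ᵥ z - P *ᵥ (M *ᵥ z))
  rw [hrv, hrr, key2] at hcs
  have hk := key1 z
  have ha := dot_self_nonneg' w
  have hb := dot_self_nonneg' z
  have hc := dot_self_nonneg' (M *ᵥ z)
  apply le_of_sq_le_sq_aux
  · exact mul_nonneg hs0 (euclNorm2_nonneg _)
  rw [mul_pow, euclNorm2_sq, euclNorm2_sq, hrr]
  generalize w ⬝ᵥ w = a at *
  generalize z ⬝ᵥ z = b at *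
  generalize (M *ᵥ z) ⬝ᵥ (M *ᵥ z) = c at *
  rcases hc.eq_or_lt with h0 | hpos
  · subst h0
    nlinarith
  · refine le_of_mul_le_mul_left ?_ hpos
    nlinarith [mul_le_mul_of_nonneg_left hk ha]
end

section
/- (Well-posedness of one step of the DEIM greedy selection.) Let U be a real n×k matrix and P a selection matrix built from k distinct indices p₁,…,p_k ∈ {1,…,n} such that PᵀU is invertible. Let u ∈ ℝⁿ, set α := (PᵀU)⁻¹ Pᵀ u and r := u − Uα. Then: (i) the residual vanishes at the previously selected indices, i.e., Pᵀr = 0; and (ii) if p ∈ {1,…,n} is any index with r_p ≠ 0 (in particular, any index maximizing |r_i| when r ≠ 0), then p ∉ {p₁,…,p_k} and the augmented (k+1)×(k+1) matrix [P, e_p]ᵀ [U, u] — obtained by appending the column u to U and the column e_p to P — is invertible. -/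
open Matrix

/-- **Well-posedness of one step of the DEIM greedy selection.** Let `P` be the selection
matrix of `k` distinct indices `p 0, …, p (k-1)` with `PᵀU` invertible. For `u ∈ ℝⁿ`, set
`α := (PᵀU)⁻¹ Pᵀ u` and `r := u − U α`. Then (i) `Pᵀ r = 0`, and (ii) for any index `q`
with `r q ≠ 0`, the index `q` is new (different from all `p j`) and the augmented matrix
`[P, e_q]ᵀ [U, u]` is invertible. -/
theorem deim_greedy_step_wellposed
    (n k : ℕ) (hn : 0 < n) (hk : 0 < k) (hkn : k < n)
    (U P : Matrix (Fin n) (Fin k) ℝ)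
    (p : Fin k → Fin n) (hp : Function.Injective p)
    (hP : ∀ i j, P i j = if i = p j then (1 : ℝ) else 0)
    (hinv : IsUnit (Pᵀ * U))
    (u : Fin n → ℝ)
    (α : Fin k → ℝ) (hα : α = (Pᵀ * U)⁻¹.mulVec (Pᵀ.mulVec u))
    (r : Fin n → ℝ) (hr : r = u - U.mulVec α) :
    Pᵀ.mulVec r = 0 ∧
    ∀ q : Fin n, r q ≠ 0 →
      (∀ j : Fin k, q ≠ p j) ∧
      IsUnit ((Matrix.of fun i => Fin.snoc (P i) (if i = q then (1 : ℝ) else 0))ᵀ *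
              (Matrix.of fun i => Fin.snoc (U i) (u i)) :
                Matrix (Fin (k + 1)) (Fin (k + 1)) ℝ) := by
  have hPT : ∀ x : Fin n → ℝ, Pᵀ.mulVec x = fun j => x (p j) := by
    intro x
    ext j
    simp [Matrix.mulVec, dotProduct, hP]
  have hdet : IsUnit (Pᵀ * U).det := (Matrix.isUnit_iff_isUnit_det _).1 hinv
  have h1 : Pᵀ.mulVec r = 0 := by
    rw [hr, Matrix.mulVec_sub, Matrix.mulVec_mulVec, hα, Matrix.mulVec_mulVec,
      Matrix.mul_nonsing_inv _ hdet, Matrix.one_mulVec, sub_self]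
  refine ⟨h1, fun q hq => ⟨?_, ?_⟩⟩
  · rintro j rfl
    apply hq
    have := congrFun h1 j
    rw [hPT] at this
    simpa using this
  · rw [← Matrix.mulVec_injective_iff_isUnit]
    rw [← Matrix.coe_mulVecLin, ← LinearMap.ker_eq_bot, LinearMap.ker_eq_bot']
    intro v hv
    rw [Matrix.mulVecLin_apply, ← Matrix.mulVec_mulVec] at hv
    obtain ⟨w, hw⟩ : ∃ w : Fin k → ℝ, w = fun j => v j.castSucc := ⟨_, rfl⟩
    obtain ⟨c, hc⟩ : ∃ c : ℝ, c = v (Fin.last k) := ⟨_, rfl⟩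
    have hW : (Matrix.of fun i => (Fin.snoc (U i) (u i) : Fin (k + 1) → ℝ)).mulVec v
        = U.mulVec (w + c • α) + c • r := by
      rw [hr, Matrix.mulVec_add, Matrix.mulVec_smul, smul_sub]
      ext i
      simp [Matrix.mulVec, dotProduct, Fin.sum_univ_castSucc, hw, hc]
      ring
    rw [hW] at hv
    have hA : Pᵀ.mulVec (U.mulVec (w + c • α) + c • r) = 0 := by
      ext j
      have := congrFun hv j.castSucc
      simpa [Matrix.mulVec, dotProduct] using this
    have hB : (U.mulVec (w + c • α) + c • r) q = 0 := by
      have := congrFun hv (Fin.last k)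
      simpa [Matrix.mulVec, dotProduct] using this
    rw [Matrix.mulVec_add, Matrix.mulVec_smul, h1, smul_zero, add_zero,
      Matrix.mulVec_mulVec] at hA
    have hz : w + c • α = 0 := by
      apply Matrix.mulVec_injective_iff_isUnit.2 hinv
      rw [hA, Matrix.mulVec_zero]
    have hc0 : c = 0 := by
      rw [hz, Matrix.mulVec_zero, zero_add] at hB
      simpa [hq] using hB
    have hw0 : w = 0 := by simpa [hc0] using hz
    ext j
    refine Fin.lastCases ?_ (fun j => ?_) j
    · rw [← hc, hc0]; rfl
    · have := congrFun hw0 j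
      rw [hw] at this
      exact this
end

section
/- (Well-definedness of the DEIM index selection.) Let u₁,…,u_ℓ ∈ ℝⁿ be linearly independent vectors. Then there exist ℓ pairwise distinct indices p₁,…,p_ℓ ∈ {1,…,n} such that for every k with 1 ≤ k ≤ ℓ, the k×k matrix M^{(k)} with entries M^{(k)}_{ij} = (u_j)_{p_i} for 1 ≤ i, j ≤ k is invertible. In particular, with U = [u₁,…,u_ℓ] and P the selection matrix of p₁,…,p_ℓ, the matrix PᵀU is nonsingular. -/
open Matrix

theorem deim_aux (n : ℕ) : ∀ (m : ℕ) (u : Fin m → (Fin n → ℝ)), LinearIndependent ℝ u →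
    ∃ p : Fin m → Fin n, ∀ k : ℕ, ∀ hk : k ≤ m,
      (Matrix.of fun i j : Fin k => u (Fin.castLE hk j) (p (Fin.castLE hk i))).det ≠ 0 := by
  intro m
  induction m with
  | zero =>
    intro u _
    refine ⟨fun i => i.elim0, fun k hk => ?_⟩
    obtain rfl : k = 0 := by omega
    simp
  | succ m ih =>
    intro u hu
    obtain ⟨p, hp⟩ := ih (fun i => u i.castSucc)
      (hu.comp Fin.castSucc (Fin.castSucc_injective m))
    have key : ∃ q : Fin n,
        (Matrix.of fun i j : Fin (m + 1) =>
          u j ((Fin.snoc p q : Fin (m + 1) → Fin n) i)).det ≠ 0 := by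
      by_contra hcon
      push Not at hcon
      have hli := Fintype.linearIndependent_iff.1 hu
        (fun j => (-1) ^ ((Fin.last m : ℕ) + (j : ℕ)) *
          (Matrix.of fun a b : Fin m => u (j.succAbove b) (p a)).det) (by
            funext q
            have h := hcon q
            rw [Matrix.det_succ_row _ (Fin.last m)] at h
            rw [Finset.sum_apply]
            simp only [Pi.smul_apply, smul_eq_mul, Pi.zero_apply]
            rw [← h]
            refine Finset.sum_congr rfl fun j _ => ?_
            have e : (Matrix.of fun a b : Fin m => u (j.succAbove b) (p a)) =
              (Matrix.of fun i j : Fin (m + 1) =>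
                u j ((Fin.snoc p q : Fin (m + 1) → Fin n) i)).submatrix
                (Fin.last m).succAbove j.succAbove := by
              ext a b
              simp
            rw [e]
            simp only [Matrix.of_apply, Fin.snoc_last]
            ring) (Fin.last m)
      have h2 := hp m le_rfl
      simp at hli
      exact h2 hli
    obtain ⟨q, hq⟩ := key
    refine ⟨Fin.snoc p q, fun k hk => ?_⟩
    rcases Nat.lt_or_ge m k with h | h
    · obtain rfl : k = m + 1 := by omega
      exact hq
    · have h3 := hp k h
      have e : ∀ i : Fin k, Fin.castLE hk i = (Fin.castLE h i).castSucc := fun i => rfl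
      simp only [e, Fin.snoc_castSucc]
      exact h3

/-- **Well-definedness of the DEIM index selection.** For linearly independent vectors
`u 0, …, u (ℓ-1) ∈ ℝⁿ` there exist `ℓ` pairwise distinct indices `p 0, …, p (ℓ-1)` such
that every leading interpolation matrix `M⁽ᵏ⁾` with entries `M⁽ᵏ⁾ i j = (u j) (p i)`
(for `i, j < k`, `1 ≤ k ≤ ℓ`) is invertible; in particular, with `U = [u 0, …, u (ℓ-1)]`
and `P` the selection matrix of the `p i`, the matrix `PᵀU` is nonsingular. -/
theorem deim_index_selection_exists
    (n ℓ : ℕ) (hn : 0 < n) (hℓ : 0 < ℓ) (hℓn : ℓ ≤ n)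
    (u : Fin ℓ → (Fin n → ℝ))
    (hu : LinearIndependent ℝ u) :
    ∃ p : Fin ℓ → Fin n, Function.Injective p ∧
      (∀ k : ℕ, 1 ≤ k → ∀ hk : k ≤ ℓ,
        IsUnit (Matrix.of fun i j : Fin k => u (Fin.castLE hk j) (p (Fin.castLE hk i)))) ∧
      IsUnit ((Matrix.of fun (i : Fin n) (j : Fin ℓ) =>
                if i = p j then (1 : ℝ) else 0)ᵀ *
              (Matrix.of fun (i : Fin n) (j : Fin ℓ) => u j i)) := by
  obtain ⟨p, hp⟩ := deim_aux n ℓ u hu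
  have hfull : (Matrix.of fun i j : Fin ℓ => u j (p i)).det ≠ 0 := hp ℓ le_rfl
  refine ⟨p, ?_, fun k _ hk => ?_, ?_⟩
  · intro a b hab
    by_contra hne
    exact hfull (Matrix.det_zero_of_row_eq hne (by funext j; simp [hab]))
  · rw [Matrix.isUnit_iff_isUnit_det]
    exact (hp k hk).isUnit
  · have e : ((Matrix.of fun (i : Fin n) (j : Fin ℓ) =>
                if i = p j then (1 : ℝ) else 0)ᵀ *
              (Matrix.of fun (i : Fin n) (j : Fin ℓ) => u j i)) =
        Matrix.of fun i j : Fin ℓ => u j (p i) := by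
      ext i j
      simp [Matrix.mul_apply]
    rw [e, Matrix.isUnit_iff_isUnit_det]
    exact hfull.isUnit
end
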